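/- Let n be an even positive integer and define I(i,j) = Σ_{m=1}^{n+1} Σ_{k=1}^{n/2+1} sin(w_m) sin(v_k) sin((i+1)w_m) sin((j+1)v_k) for non-negative integers i, j. Then for all non-negative integers ν, μ (with the index pairs non-negative): I(ν(n+2), μ(n+3)) = I(ν(n+2)−2, μ(n+3)−2) = ((n+2)(n+3)/16)·[(−1)^ν + (−1)^μ], and I(ν(n+2), μ(n+3)−2) = I(ν(n+2)−2, μ(n+3)) = −((n+2)(n+3)/16)·[(−1)^ν + (−1)^μ]. -/

import Mathlib

open Real Finset

/-- Angles `w_m = mπ/(n+2)` of the Morrow–Patterson points. -/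
noncomputable def mpW (n m : ℕ) : ℝ := m * π / (n + 2)

/-- Angles `v_k` of the Morrow–Patterson points (depending on the parity of `m`). -/
noncomputable def mpV (n m k : ℕ) : ℝ :=
  if Odd m then 2 * k * π / (n + 3) else (2 * k - 1) * π / (n + 3)

/-- The sum `I(i,j) = Σ_m Σ_k sin(w_m) sin(v_k) sin((i+1)w_m) sin((j+1)v_k)`,
for integer indices `i, j`. -/
noncomputable def mpI (n : ℕ) (i j : ℤ) : ℝ :=
  ∑ m ∈ Finset.Icc 1 (n + 1), ∑ k ∈ Finset.Icc 1 (n / 2 + 1),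
    Real.sin (mpW n m) * Real.sin (mpV n m k) *
      Real.sin (((i : ℝ) + 1) * mpW n m) * Real.sin (((j : ℝ) + 1) * mpV n m k)

theorem aux_cos_sum (a θ : ℝ) (K : ℕ) :
    2 * sin θ * ∑ k ∈ range K, cos (a + 2 * k * θ) = sin (a + (2 * K - 1) * θ) - sin (a - θ) := by
  induction K with
  | zero => simp [sub_eq_add_neg]
  | succ K ih =>
    rw [sum_range_succ, mul_add, ih]
    have e1 : a + (2 * (K : ℝ) - 1) * θ = (a + 2 * K * θ) - θ := by ring
    have e2 : a + (2 * ((K + 1 : ℕ) : ℝ) - 1) * θ = (a + 2 * K * θ) + θ := by push_cast; ring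
    rw [e1, e2, sin_add, sin_sub (a + 2 * K * θ)]
    ring

theorem aux_sq_sum (a θ c : ℝ) (K : ℕ) (h0 : sin θ ≠ 0)
    (h : sin (2 * a + (2 * K - 1) * θ) - sin (2 * a - θ) = 2 * sin θ * c) :
    ∑ k ∈ range K, sin (a + k * θ) ^ 2 = K / 2 - c / 2 := by
  have h1 := aux_cos_sum (2 * a) θ K
  rw [h] at h1
  have h2 : ∑ k ∈ range K, cos (2 * a + 2 * k * θ) = c :=
    mul_left_cancel₀ (by simpa using h0) h1
  rw [← h2, sum_div, eq_sub_iff_add_eq, ← sum_add_distrib]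
  have : ∀ k ∈ range K, sin (a + k * θ) ^ 2 + cos (2 * a + 2 * k * θ) / 2 = 1 / 2 := by
    intro k _
    rw [sin_sq_eq_half_sub]
    ring_nf
  rw [sum_congr rfl this]
  simp
  ring

theorem aux_Icc (f : ℕ → ℝ) (K : ℕ) : ∑ k ∈ Icc 1 K, f k = ∑ k ∈ range K, f (k + 1) := by
  induction K with
  | zero => simp
  | succ K ih => rw [sum_Icc_succ_top (by omega), ih, sum_range_succ]

theorem aux_split (f : ℕ → ℝ) (t : ℕ) :
    ∑ m ∈ Icc 1 (2 * t + 1), f m =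
      ∑ l ∈ range (t + 1), f (2 * l + 1) + ∑ l ∈ range t, f (2 * l + 2) := by
  rw [aux_Icc]
  induction t with
  | zero => simp
  | succ t ih =>
    rw [show 2 * (t + 1) + 1 = 2 * t + 1 + 1 + 1 by ring, sum_range_succ, sum_range_succ, ih,
      sum_range_succ _ (t + 1), sum_range_succ (fun l => f (2 * l + 2)) t]
    rw [show 2 * t + 1 + 1 + 1 = 2 * (t + 1) + 1 by ring]
    ring

theorem aux_A (t : ℕ) :
    ∑ k ∈ range (t + 1), sin (2 * ((k + 1 : ℕ) : ℝ) * π / (2 * t + 3)) ^ 2 = (2 * t + 3) / 4 := by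
  have hp : (0 : ℝ) < 2 * t + 3 := by positivity
  have hs : sin (2 * π / (2 * t + 3)) ≠ 0 := by
    apply ne_of_gt; apply sin_pos_of_pos_of_lt_pi
    · positivity
    · rw [div_lt_iff₀ hp]
      nlinarith [pi_pos, (Nat.cast_nonneg t : (0 : ℝ) ≤ t), mul_nonneg (Nat.cast_nonneg t : (0 : ℝ) ≤ t) pi_pos.le]
  have := aux_sq_sum (2 * π / (2 * t + 3)) (2 * π / (2 * t + 3)) (-1 / 2) (t + 1) hs (by
    rw [show 2 * (2 * π / (2 * t + 3)) + (2 * ((t + 1 : ℕ) : ℝ) - 1) * (2 * π / (2 * t + 3)) = 2 * π by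
      push_cast; field_simp; ring, sin_two_pi]
    ring_nf)
  rw [show (2 * (t : ℝ) + 3) / 4 = ((t + 1 : ℕ) : ℝ) / 2 - (-1 / 2) / 2 by push_cast; ring, ← this]
  refine sum_congr rfl fun k _ => ?_
  congr 2; push_cast; ring

theorem aux_B (t : ℕ) :
    ∑ k ∈ range (t + 1), sin ((2 * ((k + 1 : ℕ) : ℝ) - 1) * π / (2 * t + 3)) ^ 2
      = (2 * t + 3) / 4 := by
  have hp : (0 : ℝ) < 2 * t + 3 := by positivity
  have hs : sin (2 * π / (2 * t + 3)) ≠ 0 := by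
    apply ne_of_gt; apply sin_pos_of_pos_of_lt_pi
    · positivity
    · rw [div_lt_iff₀ hp]
      nlinarith [pi_pos, (Nat.cast_nonneg t : (0 : ℝ) ≤ t), mul_nonneg (Nat.cast_nonneg t : (0 : ℝ) ≤ t) pi_pos.le]
  have := aux_sq_sum (π / (2 * t + 3)) (2 * π / (2 * t + 3)) (-1 / 2) (t + 1) hs (by
    rw [show 2 * (π / (2 * t + 3)) + (2 * ((t + 1 : ℕ) : ℝ) - 1) * (2 * π / (2 * t + 3))
        = 2 * π - 2 * π / (2 * t + 3) by push_cast; field_simp; ring, sin_two_pi_sub,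
      show 2 * (π / (2 * t + 3)) - 2 * π / (2 * t + 3) = 0 by ring, sin_zero]
    ring_nf)
  rw [show (2 * (t : ℝ) + 3) / 4 = ((t + 1 : ℕ) : ℝ) / 2 - (-1 / 2) / 2 by push_cast; ring, ← this]
  refine sum_congr rfl fun k _ => ?_
  congr 2; push_cast; ring

theorem aux_sin_ne (t : ℕ) (ht : 0 < t) : sin (2 * π / (2 * t + 2)) ≠ 0 := by
  have hp : (0 : ℝ) < 2 * t + 2 := by positivity
  have ht' : (0 : ℝ) < t := by exact_mod_cast ht
  apply ne_of_gt; apply sin_pos_of_pos_of_lt_pi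
  · positivity
  · rw [div_lt_iff₀ hp]
    nlinarith [pi_pos, mul_pos ht' pi_pos]

theorem aux_odd (t : ℕ) (ht : 0 < t) :
    ∑ l ∈ range (t + 1), sin (((2 * l + 1 : ℕ) : ℝ) * π / (2 * t + 2)) ^ 2 = (2 * t + 2) / 4 := by
  have hp : (0 : ℝ) < 2 * t + 2 := by positivity
  have := aux_sq_sum (π / (2 * t + 2)) (2 * π / (2 * t + 2)) 0 (t + 1) (aux_sin_ne t ht) (by
    rw [show 2 * (π / (2 * t + 2)) + (2 * ((t + 1 : ℕ) : ℝ) - 1) * (2 * π / (2 * t + 2))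
        = 2 * π by push_cast; field_simp; ring, sin_two_pi,
      show 2 * (π / (2 * t + 2)) - 2 * π / (2 * t + 2) = 0 by ring, sin_zero]
    ring_nf)
  rw [show (2 * (t : ℝ) + 2) / 4 = ((t + 1 : ℕ) : ℝ) / 2 - 0 / 2 by push_cast; ring, ← this]
  refine sum_congr rfl fun k _ => ?_
  congr 2; push_cast; ring

theorem aux_even (t : ℕ) (ht : 0 < t) :
    ∑ l ∈ range t, sin (((2 * l + 2 : ℕ) : ℝ) * π / (2 * t + 2)) ^ 2 = (2 * t + 2) / 4 := by
  have hp : (0 : ℝ) < 2 * t + 2 := by positivity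
  have := aux_sq_sum (2 * π / (2 * t + 2)) (2 * π / (2 * t + 2)) (-1) t (aux_sin_ne t ht) (by
    rw [show 2 * (2 * π / (2 * t + 2)) + (2 * (t : ℝ) - 1) * (2 * π / (2 * t + 2))
        = 2 * π - 2 * π / (2 * t + 2) by field_simp; ring, sin_two_pi_sub,
      show 2 * (2 * π / (2 * t + 2)) - 2 * π / (2 * t + 2) = 2 * π / (2 * t + 2) by ring]
    ring_nf)
  rw [show (2 * (t : ℝ) + 2) / 4 = (t : ℝ) / 2 - (-1) / 2 by ring, ← this]
  refine sum_congr rfl fun k _ => ?_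
  congr 2; push_cast; ring

theorem aux_sin_shift (x ε : ℝ) (p : ℕ) (hε : ε = 1 ∨ ε = -1) :
    sin (p * π + ε * x) = (-1) ^ p * ε * sin x := by
  rw [add_comm, sin_add_nat_mul_pi]
  rcases hε with rfl | rfl <;> simp

theorem aux_main (t : ℕ) (ht : 0 < t) (ν μ : ℕ) (i j : ℤ) (ε δ : ℝ)
    (hε : ε = 1 ∨ ε = -1) (hδ : δ = 1 ∨ δ = -1)
    (hi : (i : ℝ) + 1 = ν * (2 * t + 2) + ε) (hj : (j : ℝ) + 1 = μ * (2 * t + 3) + δ) :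
    mpI (2 * t) i j =
      ε * δ * (((2 * (t : ℝ) + 2) * (2 * t + 3) / 16) * ((-1 : ℝ) ^ ν + (-1 : ℝ) ^ μ)) := by
  have hp3 : (2 * (t : ℝ) + 3) ≠ 0 := by positivity
  have hp2 : (2 * (t : ℝ) + 2) ≠ 0 := by positivity
  unfold mpI
  rw [aux_split]
  have hodd : ∀ l ∈ range (t + 1), (∑ k ∈ Icc 1 (2 * t / 2 + 1),
      sin (mpW (2 * t) (2 * l + 1)) * sin (mpV (2 * t) (2 * l + 1) k) *
      sin (((i : ℝ) + 1) * mpW (2 * t) (2 * l + 1)) *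
      sin (((j : ℝ) + 1) * mpV (2 * t) (2 * l + 1) k)) =
      sin (((2 * l + 1 : ℕ) : ℝ) * π / (2 * t + 2)) ^ 2 *
        (ε * δ * (-1) ^ ν * ((2 * t + 3) / 4)) := by
    intro l _
    rw [aux_Icc, show 2 * t / 2 + 1 = t + 1 by omega, ← aux_A, mul_sum, mul_sum]
    refine sum_congr rfl fun k _ => ?_
    have ho : Odd (2 * l + 1) := ⟨l, rfl⟩
    simp only [mpW, mpV, if_pos ho]
    have e2 : ((2 * t : ℕ) : ℝ) = 2 * t := by push_cast; ring
    rw [e2, hi, hj]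
    have s1 := aux_sin_shift (((2 * l + 1 : ℕ) : ℝ) * π / (2 * t + 2)) ε (ν * (2 * l + 1)) hε
    have s2 := aux_sin_shift (2 * ((k + 1 : ℕ) : ℝ) * π / (2 * t + 3)) δ (μ * (2 * (k + 1))) hδ
    rw [show (ν * (2 * t + 2) + ε) * (((2 * l + 1 : ℕ) : ℝ) * π / (2 * t + 2)) =
      ((ν * (2 * l + 1) : ℕ) : ℝ) * π + ε * (((2 * l + 1 : ℕ) : ℝ) * π / (2 * t + 2)) by
        push_cast; field_simp, s1]
    rw [show (μ * (2 * t + 3) + δ) * (2 * ((k + 1 : ℕ) : ℝ) * π / (2 * t + 3)) =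
      ((μ * (2 * (k + 1)) : ℕ) : ℝ) * π + δ * (2 * ((k + 1 : ℕ) : ℝ) * π / (2 * t + 3)) by
        push_cast; field_simp, s2]
    have p1 : (-1 : ℝ) ^ (ν * (2 * l + 1)) = (-1) ^ ν := by
      rw [mul_comm, pow_mul, ho.neg_one_pow]
    have p2 : (-1 : ℝ) ^ (μ * (2 * (k + 1))) = 1 := by
      rw [mul_comm, mul_assoc, pow_mul]; simp
    rw [p1, p2]
    ring
  have heven : ∀ l ∈ range t, (∑ k ∈ Icc 1 (2 * t / 2 + 1),
      sin (mpW (2 * t) (2 * l + 2)) * sin (mpV (2 * t) (2 * l + 2) k) *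
      sin (((i : ℝ) + 1) * mpW (2 * t) (2 * l + 2)) *
      sin (((j : ℝ) + 1) * mpV (2 * t) (2 * l + 2) k)) =
      sin (((2 * l + 2 : ℕ) : ℝ) * π / (2 * t + 2)) ^ 2 *
        (ε * δ * (-1) ^ μ * ((2 * t + 3) / 4)) := by
    intro l _
    rw [aux_Icc, show 2 * t / 2 + 1 = t + 1 by omega, ← aux_B, mul_sum, mul_sum]
    refine sum_congr rfl fun k _ => ?_
    have ho : ¬ Odd (2 * l + 2) := by
      rw [Nat.not_odd_iff_even]; exact ⟨l + 1, by ring⟩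
    simp only [mpW, mpV, if_neg ho]
    have e2 : ((2 * t : ℕ) : ℝ) = 2 * t := by push_cast; ring
    rw [e2, hi, hj]
    have s1 := aux_sin_shift (((2 * l + 2 : ℕ) : ℝ) * π / (2 * t + 2)) ε (ν * (2 * l + 2)) hε
    have s2 := aux_sin_shift ((2 * ((k + 1 : ℕ) : ℝ) - 1) * π / (2 * t + 3)) δ (μ * (2 * k + 1)) hδ
    rw [show (ν * (2 * t + 2) + ε) * (((2 * l + 2 : ℕ) : ℝ) * π / (2 * t + 2)) =
      ((ν * (2 * l + 2) : ℕ) : ℝ) * π + ε * (((2 * l + 2 : ℕ) : ℝ) * π / (2 * t + 2)) by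
        push_cast; field_simp, s1]
    rw [show (μ * (2 * t + 3) + δ) * ((2 * ((k + 1 : ℕ) : ℝ) - 1) * π / (2 * t + 3)) =
      ((μ * (2 * k + 1) : ℕ) : ℝ) * π + δ * ((2 * ((k + 1 : ℕ) : ℝ) - 1) * π / (2 * t + 3)) by
        push_cast; field_simp; ring, s2]
    have p1 : (-1 : ℝ) ^ (ν * (2 * l + 2)) = 1 := by
      rw [mul_comm, show 2 * l + 2 = 2 * (l + 1) by ring, mul_assoc, pow_mul]; simp
    have p2 : (-1 : ℝ) ^ (μ * (2 * k + 1)) = (-1) ^ μ := by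
      rw [mul_comm, pow_mul, Odd.neg_one_pow (n := 2 * k + 1) ⟨k, rfl⟩]
    rw [p1, p2]
    ring
  rw [sum_congr rfl hodd, sum_congr rfl heven, ← sum_mul, ← sum_mul, aux_odd t ht, aux_even t ht]
  ring

/-- For non-negative integers `ν, μ` (with the index pairs non-negative):
`I(ν(n+2), μ(n+3)) = I(ν(n+2)-2, μ(n+3)-2) = ((n+2)(n+3)/16)·[(-1)^ν + (-1)^μ]` and
`I(ν(n+2), μ(n+3)-2) = I(ν(n+2)-2, μ(n+3)) = -((n+2)(n+3)/16)·[(-1)^ν + (-1)^μ]`. -/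
theorem mpI_special_values (n : ℕ) (hn : 0 < n) (hne : Even n) (ν μ : ℕ)
    (hν : 2 ≤ (ν : ℤ) * (n + 2)) (hμ : 2 ≤ (μ : ℤ) * (n + 3)) :
    mpI n ((ν : ℤ) * (n + 2)) ((μ : ℤ) * (n + 3)) =
        (((n : ℝ) + 2) * ((n : ℝ) + 3) / 16) * ((-1 : ℝ) ^ ν + (-1 : ℝ) ^ μ) ∧
      mpI n ((ν : ℤ) * (n + 2) - 2) ((μ : ℤ) * (n + 3) - 2) =
        (((n : ℝ) + 2) * ((n : ℝ) + 3) / 16) * ((-1 : ℝ) ^ ν + (-1 : ℝ) ^ μ) ∧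
      mpI n ((ν : ℤ) * (n + 2)) ((μ : ℤ) * (n + 3) - 2) =
        -((((n : ℝ) + 2) * ((n : ℝ) + 3) / 16) * ((-1 : ℝ) ^ ν + (-1 : ℝ) ^ μ)) ∧
      mpI n ((ν : ℤ) * (n + 2) - 2) ((μ : ℤ) * (n + 3)) =
        -((((n : ℝ) + 2) * ((n : ℝ) + 3) / 16) * ((-1 : ℝ) ^ ν + (-1 : ℝ) ^ μ)) := by
  obtain ⟨t, rfl⟩ := hne
  obtain rfl | ht := Nat.eq_zero_or_pos t
  · omega
  rw [← two_mul] at *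
  refine ⟨?_, ?_, ?_, ?_⟩
  · rw [aux_main t ht ν μ _ _ 1 1 (by simp) (by simp) (by push_cast; ring) (by push_cast; ring)]
    push_cast; ring
  · rw [aux_main t ht ν μ _ _ (-1) (-1) (by simp) (by simp) (by push_cast; ring)
      (by push_cast; ring)]
    push_cast; ring
  · rw [aux_main t ht ν μ _ _ 1 (-1) (by simp) (by simp) (by push_cast; ring) (by push_cast; ring)]
    push_cast; ring
  · rw [aux_main t ht ν μ _ _ (-1) 1 (by simp) (by simp) (by push_cast; ring) (by push_cast; ring)]
    push_cast; ring
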